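/- Let K be a field, let E, E' and F be finite-dimensional K-vector spaces, let B : E → F and A : E' → F be linear transformations, and let r = dim Im B. Then for ξ ∈ E', there exists η ∈ E with Aξ + Bη = 0 if and only if ξ ∈ Ker( (ad^r B) ∘ A ), where (ad^r B) ∘ A : E' → Hom_K(Λ^r E, Λ^{r+1} F). -/

import Mathlib

open ExteriorAlgebra

theorem ιMulti_ne_zero_of_linearIndependent {K F : Type*} [Field K] [AddCommGroup F] [Module K F]
    {n : ℕ} {v : Fin n → F} (hv : LinearIndependent K v) : ExteriorAlgebra.ιMulti K n v ≠ 0 := by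
  intro h
  obtain ⟨g, hg⟩ := LinearMap.exists_extend
    ((Finsupp.linearEquivFunOnFinite K K (Fin n)).toLinearMap ∘ₗ hv.repr)
  have hgv : ∀ i, g (v i) = Pi.basisFun K (Fin n) i := by
    intro i
    have h1 := LinearMap.congr_fun hg ⟨v i, Submodule.subset_span ⟨i, rfl⟩⟩
    have h2 := hv.repr_eq_single i ⟨v i, Submodule.subset_span ⟨i, rfl⟩⟩ rfl
    simp only [LinearMap.comp_apply, Submodule.subtype_apply, h2] at h1
    rw [h1]
    simp
  have h0 : exteriorPower.ιMulti K n v = 0 := Subtype.ext h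
  have h3 := exteriorPower.alternatingMapLinearEquiv_apply_ιMulti
    ((Pi.basisFun K (Fin n)).det.compLinearMap g) v
  rw [h0, map_zero, AlternatingMap.compLinearMap_apply] at h3
  simp only [Function.comp_def, hgv] at h3
  exact zero_ne_one (h3.trans (Pi.basisFun K (Fin n)).det_self)

/-- If `A : E' → F`, `B : E → F` are linear with `r = dim Im B`, then
`Aξ + Bη = 0` for some `η` if and only if `ξ ∈ Ker ((ad^r B) ∘ A)`,
i.e. iff all the wedge products `Aξ ∧ Bη₁ ∧ ⋯ ∧ Bη_r` vanish. -/
theorem solvable_iff_ker_ad_comp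
    (K E E' F : Type*) [Field K]
    [AddCommGroup E] [Module K E] [AddCommGroup E'] [Module K E']
    [AddCommGroup F] [Module K F]
    [FiniteDimensional K E] [FiniteDimensional K E'] [FiniteDimensional K F]
    (B : E →ₗ[K] F) (A : E' →ₗ[K] F) (r : ℕ)
    (hr : r = Module.finrank K (LinearMap.range B)) :
    ∀ ξ : E', (∃ η : E, A ξ + B η = 0) ↔
      ∀ η : Fin r → E,
        ExteriorAlgebra.ι K (A ξ) *
          (List.ofFn fun i : Fin r => ExteriorAlgebra.ι K (B (η i))).prod = 0 := by
  intro ξ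
  have key : ∀ η : Fin r → E, ExteriorAlgebra.ι K (A ξ) *
      (List.ofFn fun i : Fin r => ExteriorAlgebra.ι K (B (η i))).prod =
      ExteriorAlgebra.ιMulti K (r + 1) (Fin.cons (A ξ) fun i => B (η i)) := by
    intro η
    rw [ExteriorAlgebra.ιMulti_apply, List.ofFn_succ, List.prod_cons]
    simp
  simp only [key]
  constructor
  · rintro ⟨η₀, h₀⟩ η
    apply AlternatingMap.map_linearDependent
    intro hli
    have hmem : ∀ i, (Fin.cons (A ξ) (fun i => B (η i)) : Fin (r + 1) → F) i ∈
        LinearMap.range B := by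
      intro i
      refine Fin.cases ?_ (fun j => ?_) i
      · exact ⟨-η₀, by rw [map_neg, Fin.cons_zero]; exact (eq_neg_of_add_eq_zero_left h₀).symm⟩
      · exact ⟨η j, by simp⟩
    have hli' : LinearIndependent K (fun i => (⟨_, hmem i⟩ : LinearMap.range B)) :=
      LinearIndependent.of_comp (LinearMap.range B).subtype hli
    have := hli'.fintype_card_le_finrank
    rw [Fintype.card_fin] at this
    omega
  · intro h
    by_contra hne
    let b := Module.finBasisOfFinrankEq K (LinearMap.range B) hr.symm
    choose η hη using fun i => (b i).2
    refine ιMulti_ne_zero_of_linearIndependent ?_ (h η)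
    have hb : LinearIndependent K (fun i => B (η i)) := by
      simp only [hη]
      exact b.linearIndependent.map' (LinearMap.range B).subtype (Submodule.ker_subtype _)
    refine hb.finCons fun hm => hne ?_
    have hle : Submodule.span K (Set.range fun i => B (η i)) ≤ LinearMap.range B := by
      rw [Submodule.span_le]
      rintro _ ⟨i, rfl⟩
      exact ⟨_, rfl⟩
    obtain ⟨e, he⟩ := hle hm
    exact ⟨-e, by rw [map_neg, he, add_neg_cancel]⟩
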